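/- (Segre type [11(13)]) Let n = 3 with coordinates (u¹,u²,u³), let λ be a nonzero real constant, define the symmetric metric g by g₁₁ = 2u³ + λ(u²)², g₁₂ = −1 − λu¹u², g₁₃ = −u¹, g₂₂ = λ(u¹)², g₂₃ = 0, g₃₃ = λ, and let U = {u ∈ ℝ³ : det g(u) < 0}. Define c_{ijk} := (1/3)(∂_j g_{ik} − ∂_k g_{ij}) and the skew-symmetric field w by w₁₂ = λ/√(−det g), w₂₃ = 0, w₃₁ = λu¹/√(−det g) (with w_{ji} = −w_{ij}, w_{ii} = 0). Then (g, c, w) satisfies conditions (cond1) on U. -/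

import Mathlib

open scoped BigOperators

/-- Partial derivative `∂_k f` in the `k`-th coordinate direction. -/
noncomputable def pd {n : ℕ} (k : Fin n) (f : (Fin n → ℝ) → ℝ) (u : Fin n → ℝ) : ℝ :=
  fderiv ℝ f u (Pi.single k 1)

/-- Conditions (cond1) for a triple `(g, c, w)` on a set `U ⊆ ℝⁿ`:
`g` is the (lower-index) metric `g_{ij}`, `c` are the lowered coefficients `c_{ijk}`,
`w` is the skew-symmetric 2-form `w_{ij}`, and `c^s_{jk} := g^{si} c_{ijk}` is computed
via the pointwise inverse matrix `(g u)⁻¹`. -/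
def Cond1 {n : ℕ} (U : Set (Fin n → ℝ))
    (g : (Fin n → ℝ) → Matrix (Fin n) (Fin n) ℝ)
    (c : (Fin n → ℝ) → Fin n → Fin n → Fin n → ℝ)
    (w : (Fin n → ℝ) → Matrix (Fin n) (Fin n) ℝ) : Prop :=
  ∀ u ∈ U,
    (∀ i j k, pd k (fun x => g x i j) u + c u i j k + c u j i k = 0) ∧
    (∀ i j k, c u i j k + c u i k j = 0) ∧
    (∀ i j k, pd k (fun x => g x i j) u + pd i (fun x => g x j k) u
        + pd j (fun x => g x k i) u = 0) ∧
    (∀ i j, w u i j + w u j i = 0) ∧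
    (∀ i j l, pd l (fun x => w x i j) u
        = ∑ s, (∑ a, (g u)⁻¹ s a * c u a i j) * w u s l) ∧
    (∀ m l p k, pd k (fun x => c x p m l) u
        + ∑ s, (∑ a, (g u)⁻¹ s a * c u a m l) * c u s p k + w u m l * w u p k = 0)

theorem pd_const' {n : ℕ} (k : Fin n) (a : ℝ) (u : Fin n → ℝ) : pd k (fun _ => a) u = 0 := by
  simp [pd]

theorem pd_coord {n : ℕ} (k i : Fin n) (u : Fin n → ℝ) :
    pd k (fun x => x i) u = if i = k then 1 else 0 := by
  have h : HasFDerivAt (fun x : Fin n → ℝ => x i)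
      (ContinuousLinearMap.proj (R := ℝ) (φ := fun _ : Fin n => ℝ) i) u :=
    (ContinuousLinearMap.proj (R := ℝ) (φ := fun _ : Fin n => ℝ) i).hasFDerivAt
  simp [pd, h.fderiv, Pi.single_apply]

theorem pd_add' {n : ℕ} (k : Fin n) (f h : (Fin n → ℝ) → ℝ) (u : Fin n → ℝ)
    (hf : DifferentiableAt ℝ f u) (hh : DifferentiableAt ℝ h u) :
    pd k (fun x => f x + h x) u = pd k f u + pd k h u := by
  simp [pd, fderiv_fun_add hf hh]

theorem pd_sub' {n : ℕ} (k : Fin n) (f h : (Fin n → ℝ) → ℝ) (u : Fin n → ℝ)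
    (hf : DifferentiableAt ℝ f u) (hh : DifferentiableAt ℝ h u) :
    pd k (fun x => f x - h x) u = pd k f u - pd k h u := by
  simp [pd, fderiv_fun_sub hf hh]

theorem pd_neg' {n : ℕ} (k : Fin n) (f : (Fin n → ℝ) → ℝ) (u : Fin n → ℝ) :
    pd k (fun x => - f x) u = - pd k f u := by
  simp [pd, fderiv_fun_neg]

theorem pd_mul' {n : ℕ} (k : Fin n) (f h : (Fin n → ℝ) → ℝ) (u : Fin n → ℝ)
    (hf : DifferentiableAt ℝ f u) (hh : DifferentiableAt ℝ h u) :
    pd k (fun x => f x * h x) u = f u * pd k h u + pd k f u * h u := by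
  simp [pd, fderiv_fun_mul hf hh, mul_comm]

theorem pd_pow' {n : ℕ} (k : Fin n) (f : (Fin n → ℝ) → ℝ) (m : ℕ) (u : Fin n → ℝ)
    (hf : DifferentiableAt ℝ f u) :
    pd k (fun x => f x ^ m) u = m * f u ^ (m - 1) * pd k f u := by
  simp [pd, fderiv_fun_pow m hf, mul_assoc]

/-- The determinant polynomial. -/
def DD (l : ℝ) (x : Fin 3 → ℝ) : ℝ :=
  l * (2 * l * x 0 ^ 2 * x 2 - 1 - 2 * l * x 0 * x 1 - x 0 ^ 4)

theorem DD_diff (l : ℝ) (u : Fin 3 → ℝ) : DifferentiableAt ℝ (DD l) u := by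
  unfold DD; fun_prop

theorem pd_DD (l : ℝ) (u : Fin 3 → ℝ) (k : Fin 3) : pd k (DD l) u =
    ![l * (4 * l * u 0 * u 2 - 2 * l * u 1 - 4 * u 0 ^ 3), -2 * l ^ 2 * u 0,
      2 * l ^ 2 * u 0 ^ 2] k := by
  unfold DD
  fin_cases k <;>
  · simp (disch := fun_prop) [pd_const', pd_coord, pd_add', pd_sub', pd_neg', pd_mul', pd_pow']
    try first | done | ring1 | (ring_nf; simp; done)

/-- The inverse square root of `-DD`. -/
noncomputable def QQ (l : ℝ) (x : Fin 3 → ℝ) : ℝ := (Real.sqrt (-DD l x))⁻¹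

theorem QQ_fderiv (l : ℝ) (u : Fin 3 → ℝ) (h : DD l u < 0) :
    HasFDerivAt (QQ l) ((QQ l u ^ 3 / 2) • fderiv ℝ (DD l) u) u := by
  have h1 := (DD_diff l u).hasFDerivAt.neg
  have h0 : -DD l u ≠ 0 := by linarith
  have h0' : Real.sqrt (-DD l u) ≠ 0 := by
    rw [Real.sqrt_ne_zero']; linarith
  have h2 := (Real.hasDerivAt_sqrt h0).inv h0'
  have h3 := h2.comp_hasFDerivAt u h1
  refine h3.congr_fderiv ?_
  ext v
  simp [QQ]
  field_simp

theorem QQ_diff (l : ℝ) (u : Fin 3 → ℝ) (h : DD l u < 0) : DifferentiableAt ℝ (QQ l) u :=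
  (QQ_fderiv l u h).differentiableAt

theorem pd_QQ (l : ℝ) (u : Fin 3 → ℝ) (h : DD l u < 0) (k : Fin 3) :
    pd k (QQ l) u = QQ l u ^ 3 / 2 * pd k (DD l) u := by
  simp [pd, (QQ_fderiv l u h).fderiv]

theorem QQ_sq (l : ℝ) (u : Fin 3 → ℝ) (h : DD l u < 0) : QQ l u ^ 2 * DD l u = -1 := by
  have : Real.sqrt (-DD l u) ^ 2 = -DD l u := Real.sq_sqrt (by linarith)
  have h0 : DD l u ≠ 0 := by linarith
  rw [QQ, inv_pow, this]
  field_simp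

/-- The metric. -/
def GG (l : ℝ) (u : Fin 3 → ℝ) : Matrix (Fin 3) (Fin 3) ℝ :=
  !![2 * u 2 + l * (u 1) ^ 2, -1 - l * u 0 * u 1, -(u 0);
     -1 - l * u 0 * u 1, l * (u 0) ^ 2, 0;
     -(u 0), 0, l]

theorem GG_det (l : ℝ) (u : Fin 3 → ℝ) : (GG l u).det = DD l u := by
  simp [GG, DD, Matrix.det_fin_three]; ring

theorem GG_inv (l : ℝ) (u : Fin 3 → ℝ) (h : DD l u < 0) (s a : Fin 3) :
    (GG l u)⁻¹ s a = - QQ l u ^ 2 * !![l ^ 2 * u 0 ^ 2, l * (1 + l * u 0 * u 1), l * u 0 ^ 3;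
      l * (1 + l * u 0 * u 1), l * (2 * u 2 + l * u 1 ^ 2) - u 0 ^ 2, u 0 * (1 + l * u 0 * u 1);
      l * u 0 ^ 3, u 0 * (1 + l * u 0 * u 1),
      (2 * u 2 + l * u 1 ^ 2) * (l * u 0 ^ 2) - (1 + l * u 0 * u 1) ^ 2] s a := by
  have hq := QQ_sq l u h
  have h0 : DD l u ≠ 0 := by linarith
  have e : - QQ l u ^ 2 = (DD l u)⁻¹ := by field_simp; linarith
  rw [e, Matrix.inv_def, GG_det, Ring.inverse_eq_inv', Matrix.smul_apply, smul_eq_mul,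
    Matrix.adjugate_fin_three]
  congr 1
  fin_cases s <;> fin_cases a <;> simp [GG] <;> ring

theorem pd_GG (l : ℝ) (u : Fin 3 → ℝ) (k i j : Fin 3) : pd k (fun x => GG l x i j) u =
    ![!![0, -(l * u 1), -1; -(l * u 1), 2 * l * u 0, 0; -1, 0, 0],
      !![2 * l * u 1, -(l * u 0), 0; -(l * u 0), 0, 0; 0, 0, 0],
      !![2, 0, 0; 0, 0, 0; 0, 0, 0]] k i j := by
  unfold GG
  fin_cases k <;> fin_cases i <;> fin_cases j <;>
  · simp (disch := fun_prop) [pd_const', pd_coord, pd_add', pd_sub', pd_neg', pd_mul', pd_pow']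
    try first | done | ring1 | (ring_nf; simp; done)

/-- Kronecker delta. -/
def dl (m j : Fin 3) : ℝ := if m = j then 1 else 0

/-- Elementary skew form `du¹ ∧ du²`. -/
def EA (j k : Fin 3) : ℝ := dl 0 j * dl 1 k - dl 1 j * dl 0 k

/-- Elementary skew form `du¹ ∧ du³`. -/
def EB (j k : Fin 3) : ℝ := dl 0 j * dl 2 k - dl 2 j * dl 0 k

/-- The coefficients `c`. -/
def CC (l : ℝ) (u : Fin 3 → ℝ) (i j k : Fin 3) : ℝ :=
  dl 0 i * (-(l * u 1 * EA j k) - EB j k) + dl 1 i * (l * u 0 * EA j k)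

theorem CC_eq (l : ℝ) (u : Fin 3 → ℝ) (i j k : Fin 3) :
    (1 / 3) * (pd j (fun x => GG l x i k) u - pd k (fun x => GG l x i j) u) = CC l u i j k := by
  rw [pd_GG, pd_GG]
  fin_cases k <;> fin_cases i <;> fin_cases j <;> simp [CC, EA, EB, dl] <;> ring

theorem pd_CC (l : ℝ) (u : Fin 3 → ℝ) (k p i j : Fin 3) :
    pd k (fun x => CC l x p i j) u = -(l * EA i j * EA p k) := by
  unfold CC
  simp (disch := fun_prop) only [pd_const', pd_coord, pd_add', pd_sub', pd_neg', pd_mul']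
  change _ * (_ - _) + _ + (_ * (_ * _ + (_ * dl 0 k + _) * _) + _) = _
  have e1 : (if (1 : Fin 3) = k then (1 : ℝ) else 0) = dl 1 k := rfl
  rw [e1]
  simp only [EA]
  ring

/-- The skew form `w`. -/
noncomputable def WW (l : ℝ) (u : Fin 3 → ℝ) (i j : Fin 3) : ℝ :=
  l * QQ l u * (EA i j - u 0 * EB i j)

theorem pd_WW (l : ℝ) (u : Fin 3 → ℝ) (h : DD l u < 0) (k i j : Fin 3) :
    pd k (fun x => WW l x i j) u =
    - l * QQ l u * dl 0 k * EB i j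
    + l * (QQ l u ^ 3 / 2 * pd k (DD l) u) * (EA i j - u 0 * EB i j) := by
  have hd := QQ_diff l u h
  have hQ' : ∀ k, pd k (fun x => QQ l x) u = QQ l u ^ 3 / 2 * pd k (DD l) u := pd_QQ l u h
  have e0 : (if (0 : Fin 3) = k then (1 : ℝ) else 0) = dl 0 k := rfl
  unfold WW
  simp (disch := fun_prop) only [pd_const', pd_coord, pd_add', pd_sub', pd_neg', pd_mul', hQ', e0]
  ring

theorem pd_DD' (l : ℝ) (u : Fin 3 → ℝ) (k : Fin 3) : pd k (DD l) u =
    l * (4 * l * u 0 * u 2 - 2 * l * u 1 - 4 * u 0 ^ 3) * dl 0 k + (-2 * l ^ 2 * u 0) * dl 1 k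
      + 2 * l ^ 2 * u 0 ^ 2 * dl 2 k := by
  rw [pd_DD]
  fin_cases k <;> simp [dl]

theorem CU_eq (l : ℝ) (u : Fin 3 → ℝ) (h : DD l u < 0) (s i j : Fin 3) :
    (∑ a, (GG l u)⁻¹ s a * CC l u a i j) =
      (GG l u)⁻¹ s 0 * (-(l * u 1 * EA i j) - EB i j) + (GG l u)⁻¹ s 1 * (l * u 0 * EA i j) := by
  simp [Fin.sum_univ_three, CC, dl]

theorem cond5 (l : ℝ) (u : Fin 3 → ℝ) (h : DD l u < 0) (i j k : Fin 3) :
    pd k (fun x => WW l x i j) u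
        = ∑ s, (∑ a, (GG l u)⁻¹ s a * CC l u a i j) * WW l u s k := by
  have hq := QQ_sq l u h
  simp only [CU_eq l u h]
  rw [pd_WW l u h, pd_DD']
  have a0 : EA 0 k = dl 1 k := by simp [EA, dl]
  have a1 : EA 1 k = - dl 0 k := by simp [EA, dl]
  have a2 : EA 2 k = 0 := by simp [EA, dl]
  have b0 : EB 0 k = dl 2 k := by simp [EB, dl]
  have b1 : EB 1 k = 0 := by simp [EB, dl]
  have b2 : EB 2 k = - dl 0 k := by simp [EB, dl]
  simp only [GG_inv l u h, Fin.sum_univ_three, WW, a0, a1, a2, b0, b1, b2]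
  generalize EA i j = A
  generalize EB i j = B
  generalize dl 0 k = d0
  generalize dl 1 k = d1
  generalize dl 2 k = d2
  generalize QQ l u = q at *
  unfold DD at hq
  simp
  linear_combination (-l * q * d0 * B) * hq

theorem cond6 (l : ℝ) (u : Fin 3 → ℝ) (h : DD l u < 0) (m j p k : Fin 3) :
    pd k (fun x => CC l x p m j) u
        + ∑ s, (∑ a, (GG l u)⁻¹ s a * CC l u a m j) * CC l u s p k
        + WW l u m j * WW l u p k = 0 := by
  have hq := QQ_sq l u h
  have c0 : CC l u 0 p k = -(l * u 1 * EA p k) - EB p k := by simp [CC, dl]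
  have c1 : CC l u 1 p k = l * u 0 * EA p k := by simp [CC, dl]
  have c2 : CC l u 2 p k = 0 := by simp [CC, dl]
  simp only [CU_eq l u h]
  rw [pd_CC]
  simp only [GG_inv l u h, Fin.sum_univ_three, WW, c0, c1, c2]
  generalize EA m j = A
  generalize EB m j = B
  generalize EA p k = A'
  generalize EB p k = B'
  generalize QQ l u = q at *
  unfold DD at hq
  simp
  linear_combination (-l * A * A') * hq

/-- Segre type [11(13)]. With `(u¹,u²,u³) = (u 0, u 1, u 2)`, `λ ≠ 0`,
metric `g = !![2u³+λ(u²)², −1−λu¹u², −u¹; −1−λu¹u², λ(u¹)², 0; −u¹, 0, λ]`,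
`U = {u : det g(u) < 0}`, `c_{ijk} = (1/3)(∂_j g_{ik} − ∂_k g_{ij})` and the skew form
with `w₁₂ = λ/√(−det g)`, `w₂₃ = 0`, `w₃₁ = λu¹/√(−det g)`, conditions (cond1) hold on `U`. -/
theorem segre_1113_first_satisfies_cond1 (l : ℝ) (hl : l ≠ 0)
    (g : (Fin 3 → ℝ) → Matrix (Fin 3) (Fin 3) ℝ)
    (hg : g = fun u => !![2 * u 2 + l * (u 1) ^ 2, -1 - l * u 0 * u 1, -(u 0);
                          -1 - l * u 0 * u 1, l * (u 0) ^ 2, 0;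
                          -(u 0), 0, l])
    (U : Set (Fin 3 → ℝ)) (hU : U = {u | (g u).det < 0})
    (c : (Fin 3 → ℝ) → Fin 3 → Fin 3 → Fin 3 → ℝ)
    (hc : c = fun u i j k =>
      (1 / 3) * (pd j (fun x => g x i k) u - pd k (fun x => g x i j) u))
    (w : (Fin 3 → ℝ) → Matrix (Fin 3) (Fin 3) ℝ)
    (hw : w = fun u =>
      !![0, l / Real.sqrt (-(g u).det), -(l * u 0 / Real.sqrt (-(g u).det));
         -(l / Real.sqrt (-(g u).det)), 0, 0;
         l * u 0 / Real.sqrt (-(g u).det), 0, 0]) :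
    Cond1 U g c w := by
  have hg' : g = GG l := hg
  have hc' : c = CC l := by
    rw [hc, hg']; funext u i j k; exact CC_eq l u i j k
  have hw' : w = WW l := by
    rw [hw, hg']; funext u
    ext i j
    simp only [GG_det]
    fin_cases i <;> fin_cases j <;> simp [WW, QQ, EA, EB, dl, div_eq_mul_inv] <;> ring
  clear hg hc hw
  subst hg' hc' hw' hU
  intro u hu
  have h : DD l u < 0 := by rw [← GG_det]; exact hu
  refine ⟨?_, ?_, ?_, ?_, cond5 l u h, cond6 l u h⟩
  · intro i j k
    rw [pd_GG]
    fin_cases k <;> fin_cases i <;> fin_cases j <;> simp [CC, EA, EB, dl] <;> ring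
  · intro i j k
    fin_cases k <;> fin_cases i <;> fin_cases j <;> simp [CC, EA, EB, dl]
  · intro i j k
    rw [pd_GG, pd_GG, pd_GG]
    fin_cases k <;> fin_cases i <;> fin_cases j <;> simp <;> ring
  · intro i j
    fin_cases i <;> fin_cases j <;> simp [WW, EA, EB, dl]
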